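/- Let P be a UNION-free SPARQL graph pattern (built from triple patterns using only AND, OPT, and FILTER) that is OPT-monotonic, i.e., for every subpattern of P of the form P₁ OPT P₂ it holds that var(P₂) ⊆ var(P₁). Then P is monotonic: for all RDF graphs G₁ ⊆ G₂, ⟦P⟧_{G₁} ⊆ ⟦P⟧_{G₂}. -/

import Mathlib

namespace SPARQL

/-- Kinds of RDF constants: IRIs, blank nodes, literals. -/
inductive Kind : Type
  | iri | blank | lit
deriving DecidableEq

/-- The countably infinite set `U` of constants, partitioned into the three
infinite sets of IRIs `I` (kind `iri`), blank nodes `B` (kind `blank`) and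
literals `L` (kind `lit`). -/
abbrev Const := Kind × ℕ

/-- The countably infinite set `V` of variables (disjoint from `U`). -/
abbrev Var := ℕ

/-- A mapping: a partial function from variables to constants with finite domain. -/
structure Mapping where
  toFun : Var → Option Const
  finite : {x : Var | toFun x ≠ none}.Finite

/-- The domain of a mapping. -/
def Mapping.dom (μ : Mapping) : Set Var := {x | μ.toFun x ≠ none}

/-- Two mappings are compatible if they agree on the intersection of their domains. -/
def Compatible (μ₁ μ₂ : Mapping) : Prop :=
  ∀ x ∈ μ₁.dom ∩ μ₂.dom, μ₁.toFun x = μ₂.toFun x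

/-- Union of two mappings (preferring the first one where both are defined). -/
def Mapping.union (μ₁ μ₂ : Mapping) : Mapping where
  toFun := fun x => match μ₁.toFun x with
    | some u => some u
    | none => μ₂.toFun x
  finite := by
    apply (μ₁.finite.union μ₂.finite).subset
    intro x hx
    simp only [Set.mem_setOf_eq] at hx
    simp only [Set.mem_union, Set.mem_setOf_eq]
    by_cases h1 : μ₁.toFun x = none
    · right; intro h2; apply hx; simp [h1, h2]
    · left; exact h1

/-- A term: either a constant or a variable. -/
inductive Term : Type
  | const : Const → Term
  | var : Var → Term

/-- A triple pattern. -/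
abbrev TriplePat := Term × Term × Term

/-- An RDF graph: a finite set of triples of constants. -/
abbrev Graph := Finset (Const × Const × Const)

/-- Variables of a term. -/
def Term.vars : Term → Set Var
  | .const _ => ∅
  | .var x => {x}

/-- Variables of a triple pattern. -/
def tripleVars (t : TriplePat) : Set Var := t.1.vars ∪ t.2.1.vars ∪ t.2.2.vars

/-- Apply a mapping to a term. -/
def Term.app (μ : Mapping) : Term → Option Const
  | .const c => some c
  | .var x => μ.toFun x

/-- Three truth values: true, false, error. -/
inductive TV : Type
  | t | f | e
deriving DecidableEq

/-- Kleene negation. -/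
def TV.neg : TV → TV
  | .t => .f
  | .f => .t
  | .e => .e

/-- Kleene conjunction. -/
def TV.and : TV → TV → TV
  | .f, _ => .f
  | _, .f => .f
  | .t, .t => .t
  | _, _ => .e

/-- Kleene disjunction. -/
def TV.or : TV → TV → TV
  | .t, _ => .t
  | _, .t => .t
  | .f, .f => .f
  | _, _ => .e

/-- Constraints: Boolean combinations of the atomic constraints
`bound(?x)`, `?x = c`, `?x = ?y`, `isIRI(?x)`, `isBlank(?x)`, `isLiteral(?x)`. -/
inductive Constraint : Type
  | bound : Var → Constraint
  | eqC : Var → Const → Constraint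
  | eqV : Var → Var → Constraint
  | isIRI : Var → Constraint
  | isBlank : Var → Constraint
  | isLiteral : Var → Constraint
  | and : Constraint → Constraint → Constraint
  | or : Constraint → Constraint → Constraint
  | not : Constraint → Constraint

/-- Three-valued evaluation of a constraint on a mapping. -/
def Constraint.eval (μ : Mapping) : Constraint → TV
  | .bound x => match μ.toFun x with
      | some _ => .t
      | none => .f
  | .eqC x c => match μ.toFun x with
      | some u => if u = c then .t else .f
      | none => .e
  | .eqV x y => match μ.toFun x, μ.toFun y with
      | some u, some v => if u = v then .t else .f
      | _, _ => .e
  | .isIRI x => match μ.toFun x with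
      | some u => if u.1 = Kind.iri then .t else .f
      | none => .e
  | .isBlank x => match μ.toFun x with
      | some u => if u.1 = Kind.blank then .t else .f
      | none => .e
  | .isLiteral x => match μ.toFun x with
      | some u => if u.1 = Kind.lit then .t else .f
      | none => .e
  | .and C D => (C.eval μ).and (D.eval μ)
  | .or C D => (C.eval μ).or (D.eval μ)
  | .not C => (C.eval μ).neg

/-- SPARQL graph patterns. -/
inductive Pattern : Type
  | triple : TriplePat → Pattern
  | and : Pattern → Pattern → Pattern
  | union : Pattern → Pattern → Pattern
  | opt : Pattern → Pattern → Pattern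
  | filter : Pattern → Constraint → Pattern

/-- `μ(t) ∈ G` for a triple pattern `t`. -/
def tripleMatch (μ : Mapping) (t : TriplePat) (G : Graph) : Prop :=
  ∃ s p o : Const, t.1.app μ = some s ∧ t.2.1.app μ = some p ∧ t.2.2.app μ = some o ∧
    (s, p, o) ∈ G

/-- Evaluation of a pattern on an RDF graph: a set of mappings. -/
def Pattern.eval (G : Graph) : Pattern → Set Mapping
  | .triple t => {μ | μ.dom = tripleVars t ∧ tripleMatch μ t G}
  | .and P₁ P₂ =>
      {μ | ∃ μ₁ ∈ P₁.eval G, ∃ μ₂ ∈ P₂.eval G, Compatible μ₁ μ₂ ∧ μ = μ₁.union μ₂}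
  | .union P₁ P₂ => P₁.eval G ∪ P₂.eval G
  | .opt P₁ P₂ =>
      {μ | ∃ μ₁ ∈ P₁.eval G, ∃ μ₂ ∈ P₂.eval G, Compatible μ₁ μ₂ ∧ μ = μ₁.union μ₂} ∪
      {μ₁ ∈ P₁.eval G | ∀ μ₂ ∈ P₂.eval G, ¬ Compatible μ₁ μ₂}
  | .filter P C => {μ ∈ P.eval G | C.eval μ = TV.t}

/-- A pattern is monotonic if enlarging the graph enlarges the answer set. -/
def Monotonic (P : Pattern) : Prop :=
  ∀ G₁ G₂ : Graph, G₁ ⊆ G₂ → P.eval G₁ ⊆ P.eval G₂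

/-- Subsumption of mappings: `μ₁ ⊑ μ₂`. -/
def Mapping.Sub (μ₁ μ₂ : Mapping) : Prop :=
  μ₁.dom ⊆ μ₂.dom ∧ ∀ x ∈ μ₁.dom, μ₁.toFun x = μ₂.toFun x

/-- Subsumption of sets of mappings: `Ω₁ ⊑ Ω₂`. -/
def SetSub (Ω₁ Ω₂ : Set Mapping) : Prop :=
  ∀ μ₁ ∈ Ω₁, ∃ μ₂ ∈ Ω₂, μ₁.Sub μ₂

/-- A pattern is weakly monotonic if enlarging the graph subsumes the old answers. -/
def WeaklyMonotonic (P : Pattern) : Prop :=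
  ∀ G₁ G₂ : Graph, G₁ ⊆ G₂ → SetSub (P.eval G₁) (P.eval G₂)

/-- Variables occurring in the triple patterns of a pattern. -/
def Pattern.vars : Pattern → Set Var
  | .triple t => tripleVars t
  | .and P Q => P.vars ∪ Q.vars
  | .union P Q => P.vars ∪ Q.vars
  | .opt P Q => P.vars ∪ Q.vars
  | .filter P _ => P.vars


/-- UNION-free patterns (built from triple patterns using only AND, OPT and FILTER). -/
def Pattern.unionFree : Pattern → Prop
  | .triple _ => True
  | .and P Q => P.unionFree ∧ Q.unionFree
  | .union _ _ => False
  | .opt P Q => P.unionFree ∧ Q.unionFree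
  | .filter P _ => P.unionFree

/-- OPT-monotonic: every subpattern `P₁ OPT P₂` satisfies `var(P₂) ⊆ var(P₁)`. -/
def Pattern.optMonotonic : Pattern → Prop
  | .triple _ => True
  | .and P Q => P.optMonotonic ∧ Q.optMonotonic
  | .union P Q => P.optMonotonic ∧ Q.optMonotonic
  | .opt P Q => P.optMonotonic ∧ Q.optMonotonic ∧ Q.vars ⊆ P.vars
  | .filter P _ => P.optMonotonic

theorem dom_union (μ₁ μ₂ : Mapping) : (μ₁.union μ₂).dom = μ₁.dom ∪ μ₂.dom := by
  ext x
  simp only [Mapping.dom, Mapping.union, Set.mem_setOf_eq, Set.mem_union]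
  cases μ₁.toFun x <;> simp

theorem union_eq_left (μ₁ μ₂ : Mapping) (h : μ₂.dom ⊆ μ₁.dom) : μ₁.union μ₂ = μ₁ := by
  have h2 : (μ₁.union μ₂).toFun = μ₁.toFun := by
    funext x
    simp only [Mapping.union]
    cases h1 : μ₁.toFun x with
    | some u => rfl
    | none =>
      by_contra h3
      exact h (show x ∈ μ₂.dom from h3) h1
  cases hA : μ₁.union μ₂ with
  | mk f hf =>
    rw [hA] at h2
    cases μ₁
    simp only at h2
    subst h2
    rfl

theorem dom_eq_vars (G : Graph) (P : Pattern) (hUF : P.unionFree) (hOM : P.optMonotonic) :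
    ∀ μ ∈ P.eval G, μ.dom = P.vars := by
  induction P with
  | triple t => intro μ h; exact h.1
  | and P Q ihP ihQ =>
    rintro μ ⟨μ₁, h1, μ₂, h2, -, rfl⟩
    rw [dom_union, ihP hUF.1 hOM.1 _ h1, ihQ hUF.2 hOM.2 _ h2]; rfl
  | union P Q _ _ => exact hUF.elim
  | opt P Q ihP ihQ =>
    rintro μ (⟨μ₁, h1, μ₂, h2, -, rfl⟩ | ⟨h1, -⟩)
    · rw [dom_union, ihP hUF.1 hOM.1 _ h1, ihQ hUF.2 hOM.2.1 _ h2]; rfl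
    · rw [ihP hUF.1 hOM.1 _ h1]
      exact (Set.union_eq_left.mpr hOM.2.2).symm
  | filter P C ih => intro μ h; exact ih hUF hOM _ h.1

theorem opt_eval (G : Graph) (P Q : Pattern) (hUF : (Pattern.opt P Q).unionFree)
    (hOM : (Pattern.opt P Q).optMonotonic) : (Pattern.opt P Q).eval G = P.eval G := by
  have key : ∀ μ₁ ∈ P.eval G, ∀ μ₂ ∈ Q.eval G, μ₁.union μ₂ = μ₁ := by
    intro μ₁ h1 μ₂ h2
    apply union_eq_left
    rw [dom_eq_vars G P hUF.1 hOM.1 _ h1, dom_eq_vars G Q hUF.2 hOM.2.1 _ h2]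
    exact hOM.2.2
  ext μ
  constructor
  · rintro (⟨μ₁, h1, μ₂, h2, -, rfl⟩ | ⟨h1, -⟩)
    · rw [key _ h1 _ h2]; exact h1
    · exact h1
  · intro h1
    by_cases h : ∃ μ₂ ∈ Q.eval G, Compatible μ μ₂
    · obtain ⟨μ₂, h2, hc⟩ := h
      exact Or.inl ⟨μ, h1, μ₂, h2, hc, (key _ h1 _ h2).symm⟩
    · exact Or.inr ⟨h1, fun μ₂ h2 hc => h ⟨μ₂, h2, hc⟩⟩

/-- every UNION-free OPT-monotonic pattern is monotonic. -/
theorem unionFree_optMonotonic_imp_monotonic (P : Pattern)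
    (hUF : P.unionFree) (hOM : P.optMonotonic) : Monotonic P := by
  intro G₁ G₂ hG
  induction P with
  | triple t =>
    rintro μ ⟨hd, s, p, o, h1, h2, h3, h4⟩
    exact ⟨hd, s, p, o, h1, h2, h3, hG h4⟩
  | and P Q ihP ihQ =>
    rintro μ ⟨μ₁, h1, μ₂, h2, hc, rfl⟩
    exact ⟨μ₁, ihP hUF.1 hOM.1 h1, μ₂, ihQ hUF.2 hOM.2 h2, hc, rfl⟩
  | union P Q _ _ => exact hUF.elim
  | opt P Q ihP ihQ =>
    rw [opt_eval G₁ P Q hUF hOM, opt_eval G₂ P Q hUF hOM]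
    exact ihP hUF.1 hOM.1
  | filter P C ih => rintro μ ⟨h1, h2⟩; exact ⟨ih hUF hOM h1, h2⟩

end SPARQL
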